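/- Let m ≥ 3 and let λ(1), …, λ(m) be partitions with at most n parts. For every integer r ≥ 1, the generalized Littlewood–Richardson coefficient satisfies f(λ(1), …, λ(m)) ≤ f(rλ(1), …, rλ(m)). In particular, if f(rλ(1), …, rλ(m)) = 1 for some r ≥ 1, then f(λ(1), …, λ(m)) ≤ 1. -/

import Mathlib

noncomputable section

open MvPolynomial

/-- The complete homogeneous symmetric polynomial of degree `k` in `n` variables. -/
def completeHomog (n k : ℕ) : MvPolynomial (Fin n) ℤ :=
  ∑ d ∈ Finset.Nat.antidiagonalTuple n k,
    monomial (Finsupp.equivFunOnFinite.symm d) 1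

/-- `hInt n k` is `completeHomog n k` for `k ≥ 0` and `0` for `k < 0`. -/
def hInt (n : ℕ) (k : ℤ) : MvPolynomial (Fin n) ℤ :=
  if 0 ≤ k then completeHomog n k.toNat else 0

/-- The Schur polynomial of a partition `lam` with at most `n` parts, via the
Jacobi–Trudi identity `s_λ = det (h_{λ_i - i + j})`. -/
def schurPoly (n : ℕ) (lam : Fin n → ℕ) : MvPolynomial (Fin n) ℤ :=
  Matrix.det (Matrix.of fun i j : Fin n => hInt n ((lam i : ℤ) + (j : ℤ) - (i : ℤ)))

/-- The Vandermonde alternant `a_δ = ∏_{i < j} (x_i - x_j)`. -/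
def vandermondePoly (n : ℕ) : MvPolynomial (Fin n) ℤ :=
  ∏ i : Fin n, ∏ j ∈ Finset.Ioi i, (X i - X j)

/-- The Littlewood–Richardson coefficient `c_{λ,μ}^{ν}` (for partitions with at
most `n` parts): the coefficient of the monomial `x^{ν + δ}`,
`δ = (n-1, n-2, …, 0)`, in `s_λ · s_μ · a_δ = Σ_ρ c_{λ,μ}^{ρ} a_{ρ+δ}`. -/
def lrCoeff (n : ℕ) (lam mu nu : Fin n → ℕ) : ℤ :=
  MvPolynomial.coeff
    (Finsupp.equivFunOnFinite.symm (fun i : Fin n => nu i + (n - 1 - (i : ℕ))))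
    (schurPoly n lam * schurPoly n mu * vandermondePoly n)

/-- The chain `ν_0 = λ(1), ν_1 = μ(1), …, ν_{m-3} = μ(m-3), ν_{m-2} = λ(m)`
used in the definition of the generalized Littlewood–Richardson coefficient. -/
def chainNu (n m : ℕ) (lam : ℕ → Fin n → ℕ) (mu : Fin (m - 3) → Fin n → ℕ)
    (j : ℕ) : Fin n → ℕ :=
  if j = 0 then lam 1
  else if j = m - 2 then lam m
  else if h : j - 1 < m - 3 then mu ⟨j - 1, h⟩ else 0

/-- The generalized Littlewood–Richardson coefficient
`f(λ(1), …, λ(m)) = Σ_{μ(1),…,μ(m-3)} c_{λ(1),μ(1)}^{λ(2)} ⋯ c_{μ(m-3),λ(m)}^{λ(m-1)}`,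
the sum over all partitions `μ(1), …, μ(m-3)` with at most `n` parts
(for `m = 3` it is `c_{λ(1),λ(3)}^{λ(2)}`).  The sum has finitely many nonzero
terms, so it is expressed as a `finsum`. -/
def genLR (n m : ℕ) (lam : ℕ → Fin n → ℕ) : ℤ :=
  ∑ᶠ mu : Fin (m - 3) → Fin n → ℕ,
    if ∀ k, Antitone (mu k) then
      ∏ j ∈ Finset.range (m - 2),
        lrCoeff n (chainNu n m lam mu j) (chainNu n m lam mu (j + 1)) (lam (j + 2))
    else 0

/-- `IsGT n μ g` says that the array `g` is a Gelfand–Tsetlin pattern with rows `0, …, n` and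
top row `μ`, extended by zero. -/
structure IsGT (n : ℕ) (μ : ℕ → ℤ) (g : ℕ → ℕ → ℤ) : Prop where
  top : ∀ i, g n i = μ i
  zero : ∀ p i, p ≤ i → g p i = 0
  above : ∀ p i, n < p → g p i = 0
  le : ∀ p i, p < n → g p i ≤ g (p + 1) i
  ge : ∀ p i, p < n → g (p + 1) (i + 1) ≤ g p i

/-- The sum of the first `n` entries of the `p`-th row. -/
def rowSum (n : ℕ) (g : ℕ → ℕ → ℤ) (p : ℕ) : ℤ := ∑ i ∈ Finset.range n, g p i

/-- The `k`-th entry of the weight of a pattern. -/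
def gtWeight (n : ℕ) (g : ℕ → ℕ → ℤ) (k : ℕ) : ℤ := rowSum n g (k + 1) - rowSum n g k

/-- The difference between the `k`-th and the `k + 1`-st entry of `lam` plus the content of the
part of the tableau of `g` which is read before the letters `≤ k` of row `i`. -/
def gtDefect (lam : ℕ → ℤ) (g : ℕ → ℕ → ℤ) (k i : ℕ) : ℤ :=
  lam k - lam (k + 1) + ∑ l ∈ Finset.range i, (g (k + 1) l - g k l)
    - ∑ l ∈ Finset.range (i + 1), (g (k + 2) l - g (k + 1) l)

/-- Patterns all of whose defects are nonnegative. -/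
def IsGood (n : ℕ) (lam : ℕ → ℤ) (g : ℕ → ℕ → ℤ) : Prop :=
  ∀ k i, k + 1 < n → i < n → 0 ≤ gtDefect lam g k i

/-- The reflection of the entries `i ≥ i₀` of row `k + 1` inside the intervals allowed by the
neighbouring rows, where the upper end for `i₀` is replaced by `t`. -/
def toggle (k i₀ : ℕ) (t : ℤ) (g : ℕ → ℕ → ℤ) : ℕ → ℕ → ℤ := fun p i =>
  if p = k + 1 ∧ i₀ ≤ i then
    (if i = i₀ then t else min (g (k + 2) i) (g k (i - 1))) + max (g (k + 2) (i + 1)) (g k i)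
      - g p i
  else g p i

theorem toggle_of_ne {k i₀ : ℕ} {t : ℤ} {g : ℕ → ℕ → ℤ} {p : ℕ} (h : p ≠ k + 1) (i : ℕ) :
    toggle k i₀ t g p i = g p i := by
  simp [toggle, h]

theorem toggle_of_lt {k i₀ : ℕ} {t : ℤ} {g : ℕ → ℕ → ℤ} {i : ℕ} (h : i < i₀) (p : ℕ) :
    toggle k i₀ t g p i = g p i := by
  simp [toggle, h]

theorem toggle_self (k i₀ : ℕ) (t : ℤ) (g : ℕ → ℕ → ℤ) :
    toggle k i₀ t g (k + 1) i₀ = t + max (g (k + 2) (i₀ + 1)) (g k i₀) - g (k + 1) i₀ := by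
  simp [toggle]

theorem toggle_succ {k i₀ : ℕ} (t : ℤ) (g : ℕ → ℕ → ℤ) {i : ℕ} (h : i₀ ≤ i) :
    toggle k i₀ t g (k + 1) (i + 1) =
      min (g (k + 2) (i + 1)) (g k i) + max (g (k + 2) (i + 2)) (g k (i + 1))
        - g (k + 1) (i + 1) := by
  have h1 : i₀ ≤ i + 1 := by omega
  have h2 : i + 1 ≠ i₀ := by omega
  simp [toggle, h1, h2]

theorem toggle_toggle (k i₀ : ℕ) (t : ℤ) (g : ℕ → ℕ → ℤ) :
    toggle k i₀ t (toggle k i₀ t g) = g := by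
  funext p i
  by_cases h : p = k + 1 ∧ i₀ ≤ i
  · obtain ⟨rfl, h⟩ := h
    simp [toggle, h]
  · simp [toggle, h]

theorem IsGT.nonneg {n : ℕ} {μ : ℕ → ℤ} {g : ℕ → ℕ → ℤ} (hg : IsGT n μ g) (p i : ℕ) :
    0 ≤ g p i := by
  induction p with
  | zero => rw [hg.zero 0 i (Nat.zero_le _)]
  | succ p ih =>
    rcases lt_or_ge p n with h | h
    · exact ih.trans (hg.le p i h)
    · rw [hg.above (p + 1) i (by omega)]

theorem IsGT.isGT_toggle {n : ℕ} {μ : ℕ → ℤ} {g : ℕ → ℕ → ℤ} (hg : IsGT n μ g) {k i₀ : ℕ} {t : ℤ}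
    (hk : k + 1 < n) (h1 : g (k + 1) i₀ ≤ t) (h2 : t ≤ g (k + 2) i₀)
    (h3 : ∀ i, i₀ = i + 1 → t ≤ g k i) : IsGT n μ (toggle k i₀ t g) := by
  have key : ∀ i, toggle k i₀ t g (k + 1) i ≤ g (k + 2) i ∧
      max (g (k + 2) (i + 1)) (g k i) ≤ toggle k i₀ t g (k + 1) i ∧
      (∀ j, i = j + 1 → toggle k i₀ t g (k + 1) i ≤ g k j) := by
    intro i
    have a1 := hg.le (k + 1) i hk
    have a2 := hg.ge (k + 1) i hk
    have a3 := hg.le k i (by omega)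
    rcases lt_trichotomy i i₀ with h | rfl | h
    · rw [toggle_of_lt h]
      refine ⟨a1, max_le a2 a3, ?_⟩
      rintro j rfl
      exact hg.ge k j (by omega)
    · rw [toggle_self]
      have := max_le a2 a3
      refine ⟨by linarith, by linarith, ?_⟩
      intro j hj
      have := h3 j hj
      linarith
    · obtain ⟨j, rfl⟩ : ∃ j, i = j + 1 := ⟨i - 1, by omega⟩
      rw [toggle_succ t g (by omega)]
      have := max_le a2 a3
      have a4 := hg.ge k j (by omega)
      have := le_min a1 a4
      have b1 := min_le_left (g (k + 2) (j + 1)) (g k j)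
      have b2 := min_le_right (g (k + 2) (j + 1)) (g k j)
      refine ⟨by linarith, by linarith, ?_⟩
      intro j' hj
      obtain rfl : j = j' := by omega
      linarith
  refine ⟨fun i => ?_, fun p i hp => ?_, fun p i hp => ?_, fun p i hp => ?_, fun p i hp => ?_⟩
  · rw [toggle_of_ne (by omega), hg.top]
  · by_cases h : p = k + 1
    · subst h
      obtain ⟨_, b, c⟩ := key i
      have hc := c (i - 1) (by omega)
      have := le_trans (le_max_right _ _) b
      rw [hg.zero k (i - 1) (by omega)] at hc
      rw [hg.zero k i (by omega)] at this
      omega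
    · rw [toggle_of_ne h, hg.zero p i hp]
  · rw [toggle_of_ne (by omega), hg.above p i hp]
  · by_cases h : p = k + 1
    · subst h
      rw [toggle_of_ne (p := k + 1 + 1) (by omega)]
      exact (key i).1
    · by_cases h' : p = k
      · subst h'
        rw [toggle_of_ne (p := p) (by omega)]
        exact (le_max_right _ _).trans (key i).2.1
      · rw [toggle_of_ne h, toggle_of_ne (by omega)]
        exact hg.le p i hp
  · by_cases h : p = k + 1
    · subst h
      rw [toggle_of_ne (p := k + 1 + 1) (by omega)]
      exact (le_max_left _ _).trans (key i).2.1
    · by_cases h' : p = k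
      · subst h'
        rw [toggle_of_ne (p := p) (by omega)]
        exact (key (i + 1)).2.2 i rfl
      · rw [toggle_of_ne h, toggle_of_ne (by omega)]
        exact hg.ge p i hp

theorem sum_toggle_add (k i₀ : ℕ) (t : ℤ) (g : ℕ → ℕ → ℤ) (N : ℕ) :
    ∑ l ∈ Finset.range (i₀ + N + 1), (toggle k i₀ t g (k + 1) l + g (k + 1) l) =
      2 * ∑ l ∈ Finset.range i₀, g (k + 1) l + t
        + (∑ l ∈ Finset.range (i₀ + N + 1), g (k + 2) l
          - ∑ l ∈ Finset.range (i₀ + 1), g (k + 2) l)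
        + (∑ l ∈ Finset.range (i₀ + N), g k l - ∑ l ∈ Finset.range i₀, g k l)
        + max (g (k + 2) (i₀ + N + 1)) (g k (i₀ + N)) := by
  induction N with
  | zero =>
    rw [Finset.sum_range_succ, add_zero, toggle_self]
    have : ∑ l ∈ Finset.range i₀, (toggle k i₀ t g (k + 1) l + g (k + 1) l) =
        2 * ∑ l ∈ Finset.range i₀, g (k + 1) l := by
      rw [Finset.mul_sum]
      refine Finset.sum_congr rfl fun l hl => ?_
      rw [toggle_of_lt (Finset.mem_range.1 hl)]
      ring
    rw [this]
    ring
  | succ N ih =>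
    rw [← add_assoc, Finset.sum_range_succ, ih, toggle_succ t g (by omega),
      Finset.sum_range_succ (fun l => g (k + 2) l) (i₀ + N + 1),
      Finset.sum_range_succ (fun l => g k l) (i₀ + N)]
    have := min_add_max (g (k + 2) (i₀ + N + 1)) (g k (i₀ + N))
    linarith

theorem IsGT.rowSum_toggle {n : ℕ} {μ : ℕ → ℤ} {g : ℕ → ℕ → ℤ} (hg : IsGT n μ g) {k i₀ : ℕ}
    (t : ℤ) (hk : k + 1 < n) (hi : i₀ < n) :
    rowSum n (toggle k i₀ t g) (k + 1) + rowSum n g (k + 1) =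
      2 * ∑ l ∈ Finset.range i₀, g (k + 1) l + t
        + (rowSum n g (k + 2) - ∑ l ∈ Finset.range (i₀ + 1), g (k + 2) l)
        + (rowSum n g k - ∑ l ∈ Finset.range i₀, g k l) := by
  obtain ⟨N, rfl⟩ : ∃ N, n = i₀ + N + 1 := ⟨n - i₀ - 1, by omega⟩
  have h := sum_toggle_add k i₀ t g N
  rw [hg.zero (k + 2) _ (by omega), hg.zero k (i₀ + N) (by omega), Finset.sum_add_distrib] at h
  have h' : rowSum (i₀ + N + 1) g k = ∑ l ∈ Finset.range (i₀ + N), g k l := by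
    rw [rowSum, Finset.sum_range_succ, hg.zero k (i₀ + N) (by omega), add_zero]
  rw [h']
  simp only [rowSum]
  rw [h]
  simp

theorem rowSum_toggle_of_ne {n k i₀ p : ℕ} {t : ℤ} {g : ℕ → ℕ → ℤ} (h : p ≠ k + 1) :
    rowSum n (toggle k i₀ t g) p = rowSum n g p :=
  Finset.sum_congr rfl fun l _ => toggle_of_ne h l

/-- `(i, k)` is the first position, in the reading order, at which `g` has a negative defect. -/
structure IsFirstBad (n : ℕ) (lam : ℕ → ℤ) (g : ℕ → ℕ → ℤ) (i k : ℕ) : Prop where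
  hk : k + 1 < n
  hi : i < n
  neg : gtDefect lam g k i < 0
  before : ∀ k' i', k' + 1 < n → i' < i → 0 ≤ gtDefect lam g k' i'
  beyond : ∀ k', k' + 1 < n → k < k' → 0 ≤ gtDefect lam g k' i

theorem IsFirstBad.unique {n : ℕ} {lam : ℕ → ℤ} {g : ℕ → ℕ → ℤ} {i k i' k' : ℕ}
    (h : IsFirstBad n lam g i k) (h' : IsFirstBad n lam g i' k') : i = i' ∧ k = k' := by
  have hi : i = i' := by
    by_contra hne
    rcases lt_or_gt_of_ne hne with hlt | hlt
    · exact absurd (h'.before k i h.hk hlt) (not_le.2 h.neg)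
    · exact absurd (h.before k' i' h'.hk hlt) (not_le.2 h'.neg)
  subst hi
  refine ⟨rfl, ?_⟩
  by_contra hne
  rcases lt_or_gt_of_ne hne with hlt | hlt
  · exact absurd (h.beyond k' h'.hk hlt) (not_le.2 h'.neg)
  · exact absurd (h'.beyond k h.hk hlt) (not_le.2 h.neg)

theorem exists_isFirstBad {n : ℕ} {lam : ℕ → ℤ} {g : ℕ → ℕ → ℤ} (h : ¬ IsGood n lam g) :
    ∃ q : ℕ × ℕ, IsFirstBad n lam g q.1 q.2 := by
  classical
  simp only [IsGood] at h
  push Not at h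
  have hex : ∃ i, i < n ∧ ∃ k, k + 1 < n ∧ gtDefect lam g k i < 0 := by
    obtain ⟨k, i, hk, hi, hneg⟩ := h
    exact ⟨i, hi, k, hk, hneg⟩
  obtain ⟨hi, k, hk, hneg⟩ := Nat.find_spec hex
  have hmin := fun i' (hi' : i' < Nat.find hex) => Nat.find_min hex hi'
  generalize Nat.find hex = i at hi hneg hmin
  have hP := Nat.findGreatest_spec (P := fun k => k + 1 < n ∧ gtDefect lam g k i < 0)
    (m := k) (n := n) (by omega) ⟨hk, hneg⟩
  have hG := fun k' => Nat.findGreatest_is_greatest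
    (P := fun k => k + 1 < n ∧ gtDefect lam g k i < 0) (n := n) (k := k')
  refine ⟨(i, Nat.findGreatest (fun k => k + 1 < n ∧ gtDefect lam g k i < 0) n),
    hP.1, hi, hP.2, fun k' i' hk' hi' => ?_, fun k' hk' hlt => ?_⟩
  · by_contra hc
    exact hmin i' hi' ⟨hi'.trans hi, k', hk', not_le.1 hc⟩
  · by_contra hc
    exact hG k' hlt (by omega) ⟨hk', not_le.1 hc⟩

theorem gtDefect_congr {lam : ℕ → ℤ} {g g' : ℕ → ℕ → ℤ} {k i : ℕ}
    (h0 : ∀ l < i, g k l = g' k l) (h1 : ∀ l < i + 1, g (k + 1) l = g' (k + 1) l)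
    (h2 : ∀ l < i + 1, g (k + 2) l = g' (k + 2) l) : gtDefect lam g k i = gtDefect lam g' k i := by
  have e1 : ∑ l ∈ Finset.range i, (g (k + 1) l - g k l) =
      ∑ l ∈ Finset.range i, (g' (k + 1) l - g' k l) :=
    Finset.sum_congr rfl fun l hl => by
      rw [h0 l (Finset.mem_range.1 hl), h1 l (by have := Finset.mem_range.1 hl; omega)]
  have e2 : ∑ l ∈ Finset.range (i + 1), (g (k + 2) l - g (k + 1) l) =
      ∑ l ∈ Finset.range (i + 1), (g' (k + 2) l - g' (k + 1) l) :=
    Finset.sum_congr rfl fun l hl => by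
      rw [h2 l (Finset.mem_range.1 hl), h1 l (Finset.mem_range.1 hl)]
  rw [gtDefect, gtDefect, e1, e2]

/-- The value at position `(i, k)` for which the defect becomes `-1`. -/
def badBound (lam : ℕ → ℤ) (g : ℕ → ℕ → ℤ) (k i : ℕ) : ℤ :=
  g (k + 1) i - gtDefect lam g k i - 1

theorem badBound_eq (lam : ℕ → ℤ) (g : ℕ → ℕ → ℤ) (k i : ℕ) :
    badBound lam g k i = lam (k + 1) - lam k - 1
      - ∑ l ∈ Finset.range i, (2 * g (k + 1) l - g k l - g (k + 2) l) + g (k + 2) i := by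
  simp only [badBound, gtDefect, Finset.sum_range_succ, Finset.sum_sub_distrib, ← Finset.mul_sum]
  ring

theorem badBound_toggle (lam : ℕ → ℤ) (g : ℕ → ℕ → ℤ) (k i : ℕ) (t : ℤ) :
    badBound lam (toggle k i t g) k i = badBound lam g k i := by
  rw [badBound_eq, badBound_eq, toggle_of_ne (by omega)]
  congr 2
  refine Finset.sum_congr rfl fun l hl => ?_
  have := Finset.mem_range.1 hl
  rw [toggle_of_lt this, toggle_of_lt this, toggle_of_lt this]

theorem IsFirstBad.bounds {n : ℕ} {lam μ : ℕ → ℤ} {g : ℕ → ℕ → ℤ} {i k : ℕ}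
    (h : IsFirstBad n lam g i k) (hg : IsGT n μ g) (hlam : ∀ k, k + 1 < n → lam (k + 1) ≤ lam k) :
    g (k + 1) i ≤ badBound lam g k i ∧ badBound lam g k i ≤ g (k + 2) i ∧
      ∀ j, i = j + 1 → badBound lam g k i ≤ g k j := by
  have hneg := h.neg
  have hk := h.hk
  refine ⟨by rw [badBound]; linarith, ?_, ?_⟩
  · rcases i with _ | j
    · rw [badBound_eq]
      have := hlam k hk
      simp
      linarith
    · have hb := h.before k j h.hk (Nat.lt_succ_self j)
      have := hg.le k j (by omega)
      simp only [badBound, gtDefect, Finset.sum_range_succ] at hb ⊢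
      linarith
  · rintro j rfl
    have hb := h.before k j h.hk (Nat.lt_succ_self j)
    have := hg.ge (k + 1) j (by omega)
    simp only [badBound, gtDefect, Finset.sum_range_succ] at hb ⊢
    simp only [add_assoc, Nat.reduceAdd] at *
    linarith

theorem IsFirstBad.isFirstBad_toggle {n : ℕ} {lam μ : ℕ → ℤ} {g : ℕ → ℕ → ℤ} {i k : ℕ}
    (h : IsFirstBad n lam g i k) (hg : IsGT n μ g) :
    IsFirstBad n lam (toggle k i (badBound lam g k i) g) i k := by
  refine ⟨h.hk, h.hi, ?_, fun k' i' hk' hi' => ?_, fun k' hk' hlt => ?_⟩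
  · have h1 := badBound_toggle lam g k i (badBound lam g k i)
    have h2 := toggle_self k i (badBound lam g k i) g
    have h3 : g (k + 1) i ≥ max (g (k + 2) (i + 1)) (g k i) :=
      max_le (hg.ge (k + 1) i h.hk) (hg.le k i (by have := h.hk; omega))
    rw [badBound] at h1
    linarith
  · rw [gtDefect_congr (g' := g)]
    · exact h.before k' i' hk' hi'
    all_goals intro l hl; exact toggle_of_lt (by omega) _
  · rw [gtDefect_congr (g' := g)]
    · exact h.beyond k' hk' hlt
    · exact fun l hl => toggle_of_lt hl _
    · exact fun l hl => toggle_of_ne (by omega) _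
    · exact fun l hl => toggle_of_ne (by omega) _

open Classical in
/-- The sign-reversing involution on the patterns which are not good. -/
def badFlip (n : ℕ) (lam : ℕ → ℤ) (g : ℕ → ℕ → ℤ) : ℕ → ℕ → ℤ :=
  if h : ∃ q : ℕ × ℕ, IsFirstBad n lam g q.1 q.2 then
    toggle h.choose.2 h.choose.1 (badBound lam g h.choose.2 h.choose.1) g
  else g

theorem IsFirstBad.badFlip_eq {n : ℕ} {lam : ℕ → ℤ} {g : ℕ → ℕ → ℤ} {i k : ℕ}
    (h : IsFirstBad n lam g i k) :
    badFlip n lam g = toggle k i (badBound lam g k i) g := by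
  have hex : ∃ q : ℕ × ℕ, IsFirstBad n lam g q.1 q.2 := ⟨(i, k), h⟩
  obtain ⟨h1, h2⟩ := hex.choose_spec.unique h
  rw [badFlip, dif_pos hex, h1, h2]

theorem IsFirstBad.not_isGood {n : ℕ} {lam : ℕ → ℤ} {g : ℕ → ℕ → ℤ} {i k : ℕ}
    (h : IsFirstBad n lam g i k) : ¬ IsGood n lam g :=
  fun hgood => absurd (hgood k i h.hk h.hi) (not_le.2 h.neg)

theorem badFlip_badFlip {n : ℕ} {lam μ : ℕ → ℤ} {g : ℕ → ℕ → ℤ} (hg : IsGT n μ g)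
    (hbad : ¬ IsGood n lam g) : badFlip n lam (badFlip n lam g) = g := by
  obtain ⟨⟨i, k⟩, h⟩ := exists_isFirstBad hbad
  rw [h.badFlip_eq, (h.isFirstBad_toggle hg).badFlip_eq, badBound_toggle, toggle_toggle]

theorem IsFirstBad.gtWeight_badFlip {n : ℕ} {lam μ : ℕ → ℤ} {g : ℕ → ℕ → ℤ} {i k : ℕ}
    (h : IsFirstBad n lam g i k) (hg : IsGT n μ g) :
    lam k + gtWeight n (badFlip n lam g) k = lam (k + 1) - 1 + gtWeight n g (k + 1) ∧
    lam (k + 1) - 1 + gtWeight n (badFlip n lam g) (k + 1) = lam k + gtWeight n g k ∧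
    ∀ l, l ≠ k → l ≠ k + 1 → gtWeight n (badFlip n lam g) l = gtWeight n g l := by
  rw [h.badFlip_eq]
  have key := hg.rowSum_toggle (badBound lam g k i) h.hk h.hi
  have e : badBound lam g k i = lam (k + 1) - lam k - 1 -
      (2 * ∑ l ∈ Finset.range i, g (k + 1) l - ∑ l ∈ Finset.range i, g k l)
      + ∑ l ∈ Finset.range (i + 1), g (k + 2) l := by
    rw [badBound_eq, Finset.sum_range_succ]
    simp only [Finset.sum_sub_distrib, ← Finset.mul_sum]
    ring
  have e0 : rowSum n (toggle k i (badBound lam g k i) g) k = rowSum n g k :=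
    rowSum_toggle_of_ne (by omega)
  have e2 : rowSum n (toggle k i (badBound lam g k i) g) (k + 2) = rowSum n g (k + 2) :=
    rowSum_toggle_of_ne (by omega)
  simp only [gtWeight, add_assoc, Nat.reduceAdd]
  refine ⟨by linarith, by linarith, fun l h1 h2 => ?_⟩
  rw [rowSum_toggle_of_ne (by omega), rowSum_toggle_of_ne (by omega)]

theorem IsGT.gtWeight_toggle {n : ℕ} {μ : ℕ → ℤ} {g : ℕ → ℕ → ℤ} (hg : IsGT n μ g) {k : ℕ}
    (hk : k + 1 < n) :
    gtWeight n (toggle k 0 (g (k + 2) 0) g) k = gtWeight n g (k + 1) ∧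
    gtWeight n (toggle k 0 (g (k + 2) 0) g) (k + 1) = gtWeight n g k ∧
    ∀ l, l ≠ k → l ≠ k + 1 →
      gtWeight n (toggle k 0 (g (k + 2) 0) g) l = gtWeight n g l := by
  have key := hg.rowSum_toggle (g (k + 2) 0) hk (i₀ := 0) (by omega)
  simp at key
  have e0 : rowSum n (toggle k 0 (g (k + 2) 0) g) k = rowSum n g k :=
    rowSum_toggle_of_ne (by omega)
  have e2 : rowSum n (toggle k 0 (g (k + 2) 0) g) (k + 2) = rowSum n g (k + 2) :=
    rowSum_toggle_of_ne (by omega)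
  simp only [gtWeight, add_assoc, Nat.reduceAdd]
  refine ⟨by linarith, by linarith, fun l h1 h2 => ?_⟩
  rw [rowSum_toggle_of_ne (by omega), rowSum_toggle_of_ne (by omega)]

theorem IsGT.gtWeight_nonneg {n : ℕ} {μ : ℕ → ℤ} {g : ℕ → ℕ → ℤ} (hg : IsGT n μ g) {k : ℕ}
    (hk : k < n) : 0 ≤ gtWeight n g k :=
  sub_nonneg.2 (Finset.sum_le_sum fun i _ => hg.le k i hk)

theorem IsGT.sum_gtWeight {n : ℕ} {μ : ℕ → ℤ} {g : ℕ → ℕ → ℤ} (hg : IsGT n μ g) :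
    ∑ k ∈ Finset.range n, gtWeight n g k = ∑ i ∈ Finset.range n, μ i := by
  simp only [gtWeight]
  rw [Finset.sum_range_sub]
  simp [rowSum, hg.top, hg.zero 0]

theorem IsGT.le_top {n : ℕ} {μ : ℕ → ℤ} {g : ℕ → ℕ → ℤ} (hg : IsGT n μ g) (p i : ℕ) (hp : p ≤ n) :
    g p i ≤ μ i := by
  induction hp using Nat.decreasingInduction with
  | of_succ p hp ih => exact (hg.le p i hp).trans ih
  | self => exact (hg.top i).le

theorem finite_isGT (n : ℕ) (μ : ℕ → ℤ) : {g | IsGT n μ g}.Finite := by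
  have hfin : (Set.univ.pi fun _ : Fin (n + 1) => Set.univ.pi fun i : Fin (n + 1) =>
      Set.Icc (0 : ℤ) (μ i)).Finite :=
    Set.Finite.pi fun _ => Set.Finite.pi fun _ => Set.finite_Icc _ _
  refine Set.Finite.of_finite_image
    (f := fun g (p : Fin (n + 1)) (i : Fin (n + 1)) => g p i) (hfin.subset ?_) ?_
  · rintro _ ⟨g, hg, rfl⟩ p - i -
    exact ⟨hg.nonneg _ _, hg.le_top _ _ (by omega)⟩
  · intro g hg g' hg' he
    funext p i
    rcases lt_or_ge n p with hp | hp
    · rw [hg.above p i hp, hg'.above p i hp]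
    · rcases lt_or_ge i p with hi | hi
      · exact congrFun (congrFun he ⟨p, by omega⟩) ⟨i, by omega⟩
      · rw [hg.zero p i hi, hg'.zero p i hi]

/-- The pattern with all rows as large as possible. -/
def maxPattern (n : ℕ) (μ : ℕ → ℤ) : ℕ → ℕ → ℤ := fun p i => if i < p ∧ p ≤ n then μ i else 0

theorem isGT_maxPattern {n : ℕ} {μ : ℕ → ℤ} (hμ : Antitone μ) (h0 : ∀ i, n ≤ i → μ i = 0) :
    IsGT n μ (maxPattern n μ) := by
  have hnn : ∀ i, 0 ≤ μ i := fun i => by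
    have := hμ (Nat.le_add_right i n)
    rwa [h0 (i + n) (by omega)] at this
  refine ⟨fun i => ?_, fun p i hp => ?_, fun p i hp => ?_, fun p i hp => ?_, fun p i hp => ?_⟩
  · rcases lt_or_ge i n with h | h
    · simp [maxPattern, h]
    · simp [maxPattern, h0 i h]
  · simp [maxPattern, hp]
  · simp [maxPattern, hp]
  · have := hnn i
    simp only [maxPattern]
    split_ifs <;> omega
  · have := hnn i
    have := hμ (Nat.le_succ i)
    simp only [maxPattern]
    split_ifs <;> omega

theorem maxPattern_succ_sub {n : ℕ} {μ : ℕ → ℤ} {p : ℕ} (hp : p < n) (l : ℕ) :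
    maxPattern n μ (p + 1) l - maxPattern n μ p l = if l = p then μ p else 0 := by
  simp only [maxPattern]
  split_ifs <;> first | omega | simp_all

theorem gtWeight_maxPattern {n : ℕ} {μ : ℕ → ℤ} {k : ℕ} (hk : k < n) :
    gtWeight n (maxPattern n μ) k = μ k := by
  rw [gtWeight, rowSum, rowSum, ← Finset.sum_sub_distrib,
    Finset.sum_congr rfl fun l _ => maxPattern_succ_sub hk l]
  simp [hk]

theorem isGood_maxPattern {n : ℕ} {μ : ℕ → ℤ} (hμ : Antitone μ) (h0 : ∀ i, n ≤ i → μ i = 0) :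
    IsGood n 0 (maxPattern n μ) := by
  intro k i hk hi
  have hnn : 0 ≤ μ k := by
    have := hμ (Nat.le_add_right k n)
    rwa [h0 (k + n) (by omega)] at this
  rw [gtDefect, Finset.sum_congr rfl fun l _ => maxPattern_succ_sub (show k < n by omega) l,
    Finset.sum_congr rfl fun l _ => maxPattern_succ_sub hk l]
  have := hμ (Nat.le_succ k)
  simp only [Finset.sum_ite_eq', Finset.mem_range, Pi.zero_apply]
  split_ifs <;> first | omega | simpa using this

theorem IsGT.eq_maxPattern {n : ℕ} {μ : ℕ → ℤ} {g : ℕ → ℕ → ℤ} (hg : IsGT n μ g)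
    (hgood : IsGood n 0 g) : g = maxPattern n μ := by
  have key : ∀ i p, i < p → p ≤ n → g p i = μ i := by
    intro i
    induction i using Nat.strong_induction_on with
    | _ i ih =>
      intro p hip hp
      induction hp using Nat.decreasingInduction with
      | self => exact hg.top i
      | of_succ p hp ih' =>
        have ih' := ih' (by omega)
        obtain ⟨k, rfl⟩ : ∃ k, p = k + 1 := ⟨p - 1, by omega⟩
        have hd := hgood k i hp (by omega)
        rw [gtDefect, Finset.sum_range_succ, Finset.sum_eq_zero, Finset.sum_eq_zero] at hd
        · have := hg.le (k + 1) i hp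
          simp only [Pi.zero_apply] at hd
          have e : k + 1 + 1 = k + 2 := rfl
          rw [e] at *
          linarith
        · intro l hl
          have := Finset.mem_range.1 hl
          rw [ih l this (k + 2) (by omega) (by omega), ih l this (k + 1) (by omega) (by omega),
            sub_self]
        · intro l hl
          have := Finset.mem_range.1 hl
          rw [ih l this k (by omega) (by omega), ih l this (k + 1) (by omega) (by omega),
            sub_self]
  funext p i
  rw [maxPattern]
  split_ifs with h
  · exact key i p h.1 h.2
  · rcases lt_or_ge i p with h' | h'
    · exact hg.above p i (by omega)
    · exact hg.zero p i h'

/-- Extension of a tuple of natural numbers by zero to an integer sequence. -/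
def zext {n : ℕ} (a : Fin n → ℕ) : ℕ → ℤ := fun i => if h : i < n then (a ⟨i, h⟩ : ℤ) else 0

theorem zext_of_lt {n : ℕ} (a : Fin n → ℕ) {i : ℕ} (h : i < n) : zext a i = a ⟨i, h⟩ := by
  simp [zext, h]

theorem zext_of_ge {n : ℕ} (a : Fin n → ℕ) {i : ℕ} (h : n ≤ i) : zext a i = 0 := by
  simp [zext, h]

theorem antitone_zext {n : ℕ} {a : Fin n → ℕ} (ha : Antitone a) : Antitone (zext a) := by
  intro i j hij
  rcases lt_or_ge j n with hj | hj
  · rw [zext_of_lt a hj, zext_of_lt a (hij.trans_lt hj)]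
    exact_mod_cast ha (by simpa using hij)
  · rw [zext_of_ge a hj]
    rw [zext]
    split_ifs <;> simp

theorem zext_mul {n : ℕ} (r : ℕ) (a : Fin n → ℕ) (i : ℕ) :
    zext (fun j => r * a j) i = r * zext a i := by
  simp only [zext]
  split_ifs <;> simp

/-- The monomial with exponents `α`. -/
def powMonomial {n : ℕ} (α : Fin n → ℕ) : MvPolynomial (Fin n) ℤ := ∏ i, X i ^ α i

theorem powMonomial_eq_monomial {n : ℕ} (α : Fin n → ℕ) :
    powMonomial α = monomial (Finsupp.equivFunOnFinite.symm α) 1 := by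
  rw [monomial_eq, Finsupp.prod_fintype _ _ (by simp)]
  simp [powMonomial]

theorem powMonomial_mul {n : ℕ} (α β : Fin n → ℕ) :
    powMonomial α * powMonomial β = powMonomial (α + β) := by
  simp [powMonomial, ← Finset.prod_mul_distrib, pow_add]

theorem rename_powMonomial {n : ℕ} (σ : Equiv.Perm (Fin n)) (α : Fin n → ℕ) :
    rename σ (powMonomial α) = powMonomial (α ∘ σ.symm) := by
  rw [powMonomial, powMonomial, map_prod,
    ← Equiv.prod_comp σ (fun i => X i ^ (α ∘ σ.symm) i)]
  simp

/-- The alternant with exponents `α`. -/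
def alternant {n : ℕ} (α : Fin n → ℕ) : MvPolynomial (Fin n) ℤ :=
  Matrix.det (Matrix.of fun i j : Fin n => (X j : MvPolynomial (Fin n) ℤ) ^ α i)

theorem alternant_eq_sum {n : ℕ} (α : Fin n → ℕ) :
    alternant α = ∑ σ : Equiv.Perm (Fin n), Equiv.Perm.sign σ • powMonomial (α ∘ σ) := by
  rw [alternant, Matrix.det_apply]
  rfl

theorem alternant_comp_swap {n : ℕ} (α : Fin n → ℕ) {a b : Fin n} (hab : a ≠ b) :
    alternant (α ∘ Equiv.swap a b) = -alternant α := by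
  have h := Matrix.det_permute (Equiv.swap a b)
    (Matrix.of fun i j : Fin n => (X j : MvPolynomial (Fin n) ℤ) ^ α i)
  rw [Equiv.Perm.sign_swap hab, Units.val_neg, Units.val_one, Int.cast_neg, Int.cast_one,
    neg_one_mul] at h
  exact h

/-- The staircase `(n - 1, n - 2, …, 0)`. -/
def staircase (n : ℕ) : Fin n → ℕ := fun i => n - 1 - (i : ℕ)

theorem strictAnti_add_staircase {n : ℕ} {a : Fin n → ℕ} (ha : Antitone a) :
    StrictAnti (a + staircase n) := by
  intro i j hij
  have h1 := ha hij.le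
  have h2 : (i : ℕ) < j := hij
  have := j.isLt
  simp only [Pi.add_apply, staircase]
  omega

theorem coeff_alternant {n : ℕ} {a b : Fin n → ℕ} (ha : Antitone a) (hb : Antitone b) :
    coeff (Finsupp.equivFunOnFinite.symm (b + staircase n)) (alternant (a + staircase n)) =
      if a = b then 1 else 0 := by
  have key : ∀ σ : Equiv.Perm (Fin n), (a + staircase n) ∘ σ = b + staircase n → σ = 1 := by
    intro σ h
    have hA := strictAnti_add_staircase ha
    have hmono : StrictMono σ := fun i j hij => by
      have := strictAnti_add_staircase hb hij
      rw [← h] at this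
      exact hA.lt_iff_gt.1 this
    have := hmono.range_inj (strictMono_id (α := Fin n)) |>.1 (by simp)
    ext i
    simp [this]
  rw [alternant_eq_sum, coeff_sum, Finset.sum_eq_single 1]
  · rw [powMonomial_eq_monomial]
    simp [coeff_monomial]
  · intro σ _ hσ
    rw [powMonomial_eq_monomial, coeff_smul, coeff_monomial, if_neg, smul_zero]
    exact fun h => hσ (key σ (Finsupp.equivFunOnFinite.symm.injective h))
  · simp

/-- The weight of a pattern as an exponent. -/
def gtExponent (n : ℕ) (g : ℕ → ℕ → ℤ) : Fin n → ℕ := fun k => (gtWeight n g k).toNat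

theorem IsGT.coe_gtExponent {n : ℕ} {μ : ℕ → ℤ} {g : ℕ → ℕ → ℤ} (hg : IsGT n μ g) (k : Fin n) :
    (gtExponent n g k : ℤ) = gtWeight n g k :=
  Int.toNat_of_nonneg (hg.gtWeight_nonneg k.isLt)

/-- The finite set of Gelfand–Tsetlin patterns with top row `μ`. -/
def gtFinset (n : ℕ) (μ : ℕ → ℤ) : Finset (ℕ → ℕ → ℤ) := (finite_isGT n μ).toFinset

theorem mem_gtFinset {n : ℕ} {μ : ℕ → ℤ} {g : ℕ → ℕ → ℤ} : g ∈ gtFinset n μ ↔ IsGT n μ g := by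
  simp [gtFinset]

/-- The generating polynomial of Gelfand–Tsetlin patterns by weight. -/
def gtPoly (n : ℕ) (μ : ℕ → ℤ) : MvPolynomial (Fin n) ℤ :=
  ∑ g ∈ gtFinset n μ, powMonomial (gtExponent n g)

theorem rename_swap_gtPoly {n : ℕ} (μ : ℕ → ℤ) {a b : Fin n} (hab : (b : ℕ) = a + 1) :
    rename (Equiv.swap a b) (gtPoly n μ) = gtPoly n μ := by
  have hn : (a : ℕ) + 1 < n := hab ▸ b.isLt
  have hmem : ∀ g ∈ gtFinset n μ, toggle a 0 (g (a + 2) 0) g ∈ gtFinset n μ := by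
    intro g hg
    rw [mem_gtFinset] at hg ⊢
    exact hg.isGT_toggle hn (hg.le _ _ hn) le_rfl (by simp)
  have hinv : ∀ g ∈ gtFinset n μ, toggle a 0 (toggle a 0 (g (a + 2) 0) g (a + 2) 0)
      (toggle a 0 (g (a + 2) 0) g) = g := by
    intro g _
    rw [toggle_of_ne (p := (a : ℕ) + 2) (by omega), toggle_toggle]
  rw [gtPoly, map_sum]
  refine Finset.sum_bij' (fun g _ => toggle a 0 (g (a + 2) 0) g)
    (fun g _ => toggle a 0 (g (a + 2) 0) g) hmem hmem hinv hinv fun g hg => ?_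
  rw [rename_powMonomial]
  congr 1
  rw [mem_gtFinset] at hg
  obtain ⟨h1, h2, h3⟩ := hg.gtWeight_toggle hn
  funext k
  simp only [Function.comp_apply, Equiv.symm_swap, gtExponent]
  congr 1
  by_cases hka : k = a
  · subst hka
    rw [Equiv.swap_apply_left, h1, hab]
  · by_cases hkb : k = b
    · subst hkb
      rw [Equiv.swap_apply_right, hab, h2]
    · rw [Equiv.swap_apply_of_ne_of_ne hka hkb, h3]
      · exact fun h => hka (Fin.ext h)
      · exact fun h => hkb (Fin.ext (h.trans hab.symm))

theorem rename_gtPoly {n : ℕ} (μ : ℕ → ℤ) (σ : Equiv.Perm (Fin n)) :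
    rename σ (gtPoly n μ) = gtPoly n μ := by
  rcases n with _ | n
  · rw [Subsingleton.elim σ 1]
    simp
  · have hσ : σ ∈ Submonoid.closure
        (Set.range fun i : Fin n => Equiv.swap i.castSucc i.succ) := by
      rw [Equiv.Perm.mclosure_swap_castSucc_succ]
      trivial
    induction hσ using Submonoid.closure_induction with
    | mem x hx =>
      obtain ⟨i, rfl⟩ := hx
      exact rename_swap_gtPoly μ (by simp)
    | one => simp
    | mul x y _ _ hx hy =>
      rw [Equiv.Perm.coe_mul, ← rename_rename, hy, hx]

theorem alternant_mul_gtPoly {n : ℕ} (μ : ℕ → ℤ) (α : Fin n → ℕ) :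
    alternant α * gtPoly n μ = ∑ g ∈ gtFinset n μ, alternant (α + gtExponent n g) := by
  simp only [alternant_eq_sum]
  rw [Finset.sum_comm, Finset.sum_mul]
  refine Finset.sum_congr rfl fun σ _ => ?_
  rw [← Finset.smul_sum, smul_mul_assoc]
  congr 1
  rw [← rename_gtPoly μ σ.symm, gtPoly, map_sum, Finset.mul_sum]
  refine Finset.sum_congr rfl fun g _ => ?_
  rw [rename_powMonomial, powMonomial_mul]
  rfl

theorem IsFirstBad.alternant_badFlip {n : ℕ} {μ : ℕ → ℤ} {lam : Fin n → ℕ} {g : ℕ → ℕ → ℤ}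
    {i k : ℕ} (h : IsFirstBad n (zext lam) g i k) (hg : IsGT n μ g)
    (hg' : IsGT n μ (badFlip n (zext lam) g)) :
    alternant (lam + staircase n + gtExponent n (badFlip n (zext lam) g)) =
      -alternant (lam + staircase n + gtExponent n g) := by
  have hk := h.hk
  obtain ⟨h1, h2, h3⟩ := h.gtWeight_badFlip hg
  set a : Fin n := ⟨k, by omega⟩ with ha
  set b : Fin n := ⟨k + 1, hk⟩ with hb
  have hab : a ≠ b := by simp [ha, hb]
  rw [← alternant_comp_swap _ hab]
  congr 1
  rw [zext_of_lt lam hk, zext_of_lt lam (show k < n by omega)] at h1 h2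
  have ea := hg.coe_gtExponent a
  have eb := hg.coe_gtExponent b
  have ea' := hg'.coe_gtExponent a
  have eb' := hg'.coe_gtExponent b
  have hsa : staircase n a = staircase n b + 1 := by
    simp only [staircase, ha, hb]
    omega
  funext l
  by_cases hla : l = a
  · simp only [hla, Function.comp_apply, Equiv.swap_apply_left, Pi.add_apply]
    simp only [ha, hb] at *
    omega
  · by_cases hlb : l = b
    · simp only [hlb, Function.comp_apply, Equiv.swap_apply_right, Pi.add_apply]
      simp only [ha, hb] at *
      omega
    · rw [Function.comp_apply, Equiv.swap_apply_of_ne_of_ne hla hlb]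
      simp only [Pi.add_apply, gtExponent]
      rw [h3]
      · exact fun h => hla (Fin.ext h)
      · exact fun h => hlb (Fin.ext h)

open Classical in
theorem alternant_mul_gtPoly_eq_sum_good {n : ℕ} (μ : ℕ → ℤ) {lam : Fin n → ℕ}
    (hlam : Antitone lam) :
    alternant (lam + staircase n) * gtPoly n μ =
      ∑ g ∈ gtFinset n μ with IsGood n (zext lam) g,
        alternant (lam + staircase n + gtExponent n g) := by
  rw [alternant_mul_gtPoly,
    ← Finset.sum_filter_add_sum_filter_not _ (fun g => IsGood n (zext lam) g), add_eq_left]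
  have hflip : ∀ g, IsGT n μ g → ¬ IsGood n (zext lam) g →
      IsGT n μ (badFlip n (zext lam) g) ∧ ¬ IsGood n (zext lam) (badFlip n (zext lam) g) ∧
      alternant (lam + staircase n + gtExponent n (badFlip n (zext lam) g)) =
        -alternant (lam + staircase n + gtExponent n g) := by
    intro g hg hbad
    obtain ⟨⟨i, k⟩, h⟩ := exists_isFirstBad hbad
    have hb := h.bounds hg fun k _ => antitone_zext hlam (Nat.le_succ k)
    have hg' : IsGT n μ (badFlip n (zext lam) g) := by
      rw [h.badFlip_eq]
      exact hg.isGT_toggle h.hk hb.1 hb.2.1 hb.2.2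
    refine ⟨hg', ?_, h.alternant_badFlip hg hg'⟩
    rw [h.badFlip_eq]
    exact (h.isFirstBad_toggle hg).not_isGood
  have hmem : ∀ g ∈ (gtFinset n μ).filter fun g => ¬ IsGood n (zext lam) g,
      IsGT n μ g ∧ ¬ IsGood n (zext lam) g := fun g hg => by
    rwa [Finset.mem_filter, mem_gtFinset] at hg
  refine Finset.sum_involution (fun g _ => badFlip n (zext lam) g) (fun g hg => ?_)
    (fun g hg hne he => hne ?_) (fun g hg => ?_) (fun g hg => ?_)
  · rw [(hflip g (hmem g hg).1 (hmem g hg).2).2.2, add_neg_cancel]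
  · have h := (hflip g (hmem g hg).1 (hmem g hg).2).2.2
    rw [he] at h
    exact self_eq_neg.1 h
  · obtain ⟨h1, h2, -⟩ := hflip g (hmem g hg).1 (hmem g hg).2
    rw [Finset.mem_filter, mem_gtFinset]
    exact ⟨h1, h2⟩
  · exact badFlip_badFlip (hmem g hg).1 (hmem g hg).2

theorem alternant_staircase_mul_gtPoly {n : ℕ} {mu : Fin n → ℕ} (hmu : Antitone mu) :
    alternant (staircase n) * gtPoly n (zext mu) = alternant (mu + staircase n) := by
  classical
  have h := alternant_mul_gtPoly_eq_sum_good (n := n) (zext mu) (lam := 0) antitone_const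
  have h0 : zext (0 : Fin n → ℕ) = 0 := by
    funext i
    simp [zext]
  have hmax := isGT_maxPattern (antitone_zext hmu) (fun i => zext_of_ge mu)
  rw [zero_add, h0] at h
  rw [h]
  have hs : (gtFinset n (zext mu)).filter (IsGood n 0) = {maxPattern n (zext mu)} := by
    ext g
    rw [Finset.mem_filter, mem_gtFinset, Finset.mem_singleton]
    constructor
    · rintro ⟨h1, h2⟩
      exact h1.eq_maxPattern h2
    · rintro rfl
      exact ⟨hmax, isGood_maxPattern (antitone_zext hmu) fun i => zext_of_ge mu⟩
  rw [hs, Finset.sum_singleton, add_comm]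
  congr 2
  funext k
  have := hmax.coe_gtExponent k
  rw [gtWeight_maxPattern k.isLt, zext_of_lt mu k.isLt] at this
  exact_mod_cast this

theorem vandermondePoly_eq_alternant (n : ℕ) : vandermondePoly n = alternant (staircase n) := by
  have h := Matrix.det_projVandermonde (fun _ : Fin n => (1 : MvPolynomial (Fin n) ℤ)) X
  simp only [one_mul] at h
  rw [vandermondePoly, ← h, alternant, ← Matrix.det_transpose]
  congr 1
  ext1 i j
  simp [Matrix.projVandermonde_apply, staircase, Fin.val_rev, Nat.sub_sub, add_comm]

theorem alternant_staircase_ne_zero (n : ℕ) : alternant (staircase n) ≠ 0 := by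
  rw [← vandermondePoly_eq_alternant, vandermondePoly]
  refine Finset.prod_ne_zero_iff.2 fun i _ => Finset.prod_ne_zero_iff.2 fun j hj => ?_
  rw [sub_ne_zero]
  exact fun h => (Finset.mem_Ioi.1 hj).ne (X_injective h)

theorem mk_pow_mul_one_sub {R : Type*} [CommRing R] (x : R) :
    PowerSeries.mk (fun k => x ^ k) * (1 - PowerSeries.C x * PowerSeries.X) = 1 := by
  ext k
  rcases k with _ | k
  · simp
  · rw [mul_sub, mul_one, mul_left_comm, map_sub, PowerSeries.coeff_C_mul,
      PowerSeries.coeff_succ_mul_X]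
    simp [PowerSeries.coeff_one, pow_succ']

theorem mk_completeHomog (n : ℕ) :
    PowerSeries.mk (completeHomog n) =
      ∏ i : Fin n, PowerSeries.mk fun k => (X i : MvPolynomial (Fin n) ℤ) ^ k := by
  ext1 k
  rw [PowerSeries.coeff_prod, PowerSeries.coeff_mk, completeHomog]
  refine Finset.sum_bij' (fun d _ => Finsupp.equivFunOnFinite.symm d) (fun l _ => l)
    (fun d hd => ?_) (fun l hl => ?_) (fun d _ => ?_) (fun l _ => ?_) (fun d _ => ?_)
  · rw [Finset.mem_finsuppAntidiag]
    exact ⟨Finset.Nat.mem_antidiagonalTuple.1 hd, Finset.subset_univ _⟩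
  · rw [Finset.Nat.mem_antidiagonalTuple]
    exact (Finset.mem_finsuppAntidiag.1 hl).1
  · rfl
  · ext
    rfl
  · rw [← powMonomial_eq_monomial, powMonomial]
    simp

/-- The series `∏_{m ≠ l} (1 - x_m t)`. -/
def elemSeries {n : ℕ} (l : Fin n) : PowerSeries (MvPolynomial (Fin n) ℤ) :=
  ∏ m ∈ Finset.univ.erase l, (1 - PowerSeries.C (X m) * PowerSeries.X)

theorem mk_completeHomog_mul_elemSeries {n : ℕ} (l : Fin n) :
    PowerSeries.mk (completeHomog n) * elemSeries l = PowerSeries.mk fun k => X l ^ k := by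
  rw [mk_completeHomog, elemSeries, ← Finset.mul_prod_erase _ _ (Finset.mem_univ l), mul_assoc,
    ← Finset.prod_mul_distrib, Finset.prod_eq_one, mul_one]
  exact fun i _ => mk_pow_mul_one_sub (X i)

theorem coeff_prod_one_sub {R ι : Type*} [CommRing R] (x : ι → R) (s : Finset ι) (q : ℕ)
    (hq : s.card < q) :
    PowerSeries.coeff q (∏ m ∈ s, (1 - PowerSeries.C (x m) * PowerSeries.X)) = 0 := by
  classical
  induction s using Finset.induction_on generalizing q with
  | empty =>
    have : q ≠ 0 := by rintro rfl; simp at hq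
    simp [PowerSeries.coeff_one, this]
  | insert a s ha ih =>
    rw [Finset.card_insert_of_notMem ha] at hq
    obtain ⟨q, rfl⟩ : ∃ p, q = p + 1 := ⟨q - 1, by omega⟩
    rw [Finset.prod_insert ha, sub_mul, one_mul, mul_assoc, map_sub, PowerSeries.coeff_C_mul,
      PowerSeries.coeff_succ_X_mul, ih _ (by omega), ih _ (by omega), mul_zero, sub_zero]

theorem coeff_elemSeries_of_le {n q : ℕ} (l : Fin n) (hq : n ≤ q) :
    PowerSeries.coeff q (elemSeries l) = 0 := by
  refine coeff_prod_one_sub _ _ _ ?_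
  rw [Finset.card_erase_of_mem (Finset.mem_univ l), Finset.card_univ, Fintype.card_fin]
  have := l.isLt
  omega

theorem sum_hInt_mul_coeff_elemSeries {n : ℕ} (l : Fin n) (a : ℕ) :
    ∑ q ∈ Finset.range n, hInt n ((a : ℤ) - q) * PowerSeries.coeff q (elemSeries l) =
      X l ^ a := by
  have h1 : ∑ q ∈ Finset.range n, hInt n ((a : ℤ) - q) * PowerSeries.coeff q (elemSeries l) =
      ∑ q ∈ Finset.range (n + (a + 1)),
        hInt n ((a : ℤ) - q) * PowerSeries.coeff q (elemSeries l) := by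
    refine Finset.sum_subset (Finset.range_mono (by omega)) fun q _ hq => ?_
    rw [coeff_elemSeries_of_le l (by simpa using hq), mul_zero]
  have h2 : ∑ q ∈ Finset.range (a + 1),
        hInt n ((a : ℤ) - q) * PowerSeries.coeff q (elemSeries l) =
      ∑ q ∈ Finset.range (n + (a + 1)),
        hInt n ((a : ℤ) - q) * PowerSeries.coeff q (elemSeries l) := by
    refine Finset.sum_subset (Finset.range_mono (by omega)) fun q _ hq => ?_
    have : ¬ (0 : ℤ) ≤ (a : ℤ) - q := by
      rw [Finset.mem_range] at hq
      omega
    rw [hInt, if_neg this, zero_mul]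
  have h3 := congrArg (PowerSeries.coeff a) (mk_completeHomog_mul_elemSeries l)
  rw [mul_comm, PowerSeries.coeff_mul, PowerSeries.coeff_mk,
    Finset.Nat.sum_antidiagonal_eq_sum_range_succ
      (fun q p => PowerSeries.coeff q (elemSeries l) *
        PowerSeries.coeff p (PowerSeries.mk (completeHomog n)))] at h3
  rw [h1, ← h2, ← h3]
  refine Finset.sum_congr rfl fun q hq => ?_
  have hq := Finset.mem_range.1 hq
  have h0 : (0 : ℤ) ≤ (a : ℤ) - q := by omega
  have h4 : ((a : ℤ) - q).toNat = a - q := by omega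
  rw [hInt, if_pos h0, h4, PowerSeries.coeff_mk, mul_comm]

/-- The coefficients of the series `∏_{m ≠ l} (1 - x_m t)` in reverse order. -/
def elemMatrix (n : ℕ) : Matrix (Fin n) (Fin n) (MvPolynomial (Fin n) ℤ) :=
  Matrix.of fun j l => PowerSeries.coeff (n - 1 - (j : ℕ)) (elemSeries l)

theorem schurPoly_mul_det_elemMatrix {n : ℕ} (lam : Fin n → ℕ) :
    schurPoly n lam * (elemMatrix n).det = alternant (lam + staircase n) := by
  rw [schurPoly, ← Matrix.det_mul, alternant]
  congr 1
  ext1 i l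
  rw [Matrix.mul_apply, Matrix.of_apply, ← sum_hInt_mul_coeff_elemSeries,
    ← Finset.sum_range_reflect, ← Fin.sum_univ_eq_sum_range (fun q =>
      hInt n (((lam + staircase n) i : ℕ) - ((n - 1 - q : ℕ) : ℤ)) *
        PowerSeries.coeff (n - 1 - q) (elemSeries l))]
  refine Finset.sum_congr rfl fun j _ => ?_
  rw [Matrix.of_apply, elemMatrix, Matrix.of_apply]
  congr 2
  have := i.isLt
  have := j.isLt
  simp only [Pi.add_apply, staircase]
  omega

theorem schurPoly_zero (n : ℕ) : schurPoly n 0 = 1 := by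
  rw [schurPoly, Matrix.det_of_isUpperTriangular]
  · refine Finset.prod_eq_one fun i _ => ?_
    simp only [Matrix.of_apply, hInt, completeHomog, Pi.zero_apply, Nat.cast_zero, zero_add,
      sub_self, le_refl, if_true, Int.toNat_zero, Finset.Nat.antidiagonalTuple_zero_right,
      Finset.sum_singleton, ← powMonomial_eq_monomial]
    simp [powMonomial]
  · intro i j hij
    have : ¬ (0 : ℤ) ≤ (((0 : Fin n → ℕ) i : ℕ) : ℤ) + (j : ℤ) - (i : ℤ) := by
      have : (j : ℕ) < i := hij
      simp only [Pi.zero_apply]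
      omega
    rw [Matrix.of_apply, hInt, if_neg this]

theorem schurPoly_mul_alternant {n : ℕ} (lam : Fin n → ℕ) :
    schurPoly n lam * alternant (staircase n) = alternant (lam + staircase n) := by
  have h := schurPoly_mul_det_elemMatrix (0 : Fin n → ℕ)
  rw [schurPoly_zero, one_mul, zero_add] at h
  rw [← h, schurPoly_mul_det_elemMatrix]

theorem schurPoly_eq_gtPoly {n : ℕ} {mu : Fin n → ℕ} (hmu : Antitone mu) :
    schurPoly n mu = gtPoly n (zext mu) := by
  refine mul_right_cancel₀ (alternant_staircase_ne_zero n) ?_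
  rw [schurPoly_mul_alternant, mul_comm, alternant_staircase_mul_gtPoly hmu]

/-- The lattice points counted by the Littlewood–Richardson coefficient. -/
def lrSet (n : ℕ) (lam mu nu : ℕ → ℤ) : Set (ℕ → ℕ → ℤ) :=
  {g | IsGT n mu g ∧ IsGood n lam g ∧ ∀ k, k < n → lam k + gtWeight n g k = nu k}

theorem finite_lrSet (n : ℕ) (lam mu nu : ℕ → ℤ) : (lrSet n lam mu nu).Finite :=
  (finite_isGT n mu).subset fun _ hg => hg.1

theorem gtDefect_last {n : ℕ} {lam μ : ℕ → ℤ} {g : ℕ → ℕ → ℤ} (hg : IsGT n μ g) {k : ℕ}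
    (hk : k + 1 < n) :
    gtDefect lam g k (n - 1) =
      lam k + gtWeight n g k - (lam (k + 1) + gtWeight n g (k + 1)) := by
  obtain ⟨m, rfl⟩ : ∃ m, n = m + 1 := ⟨n - 1, by omega⟩
  simp only [gtDefect, gtWeight, rowSum, Finset.sum_sub_distrib, Finset.sum_range_succ,
    add_tsub_cancel_right]
  rw [hg.zero k m (by omega), hg.zero (k + 1) m (by omega)]
  ring

theorem lrCoeff_eq_ncard {n : ℕ} {lam mu nu : Fin n → ℕ} (hlam : Antitone lam)
    (hmu : Antitone mu) (hnu : Antitone nu) :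
    lrCoeff n lam mu nu = (lrSet n (zext lam) (zext mu) (zext nu)).ncard := by
  classical
  rw [lrCoeff, vandermondePoly_eq_alternant, mul_right_comm, schurPoly_mul_alternant,
    schurPoly_eq_gtPoly hmu, alternant_mul_gtPoly_eq_sum_good _ hlam, coeff_sum]
  have hterm : ∀ g ∈ (gtFinset n (zext mu)).filter (IsGood n (zext lam)),
      coeff (Finsupp.equivFunOnFinite.symm fun i : Fin n => nu i + (n - 1 - (i : ℕ)))
        (alternant (lam + staircase n + gtExponent n g)) =
      if g ∈ lrSet n (zext lam) (zext mu) (zext nu) then 1 else 0 := by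
    intro g hg
    rw [Finset.mem_filter, mem_gtFinset] at hg
    obtain ⟨hg, hgood⟩ := hg
    have hanti : Antitone (lam + gtExponent n g) := by
      rcases n with _ | n
      · exact fun i => i.elim0
      refine Fin.antitone_iff_succ_le.2 fun k => ?_
      have hk := k.isLt
      have h := hgood k (n + 1 - 1) (by omega) (by omega)
      rw [gtDefect_last hg (by omega), zext_of_lt lam (by omega), zext_of_lt lam (by omega)] at h
      have h1 := hg.coe_gtExponent k.castSucc
      have h2 := hg.coe_gtExponent k.succ
      simp only [Fin.val_castSucc, Fin.val_succ] at h1 h2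
      have e1 : (⟨k, by omega⟩ : Fin (n + 1)) = k.castSucc := rfl
      have e2 : (⟨k + 1, by omega⟩ : Fin (n + 1)) = k.succ := rfl
      rw [e1, e2] at h
      simp only [Pi.add_apply]
      omega
    have := coeff_alternant hanti hnu
    rw [add_right_comm]
    refine this.trans (if_congr ?_ rfl rfl)
    constructor
    · rintro rfl
      refine ⟨hg, hgood, fun k hk => ?_⟩
      have := hg.coe_gtExponent ⟨k, hk⟩
      rw [zext_of_lt _ hk, zext_of_lt _ hk, Pi.add_apply, Nat.cast_add, this]
    · rintro ⟨-, -, h⟩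
      funext k
      have h1 := h k k.isLt
      rw [zext_of_lt _ k.isLt, zext_of_lt _ k.isLt, ← hg.coe_gtExponent k] at h1
      exact_mod_cast h1
  rw [Finset.sum_congr rfl hterm, Finset.sum_boole, ← Set.ncard_coe_finset]
  congr 2
  ext g
  simp only [Finset.coe_filter, Finset.mem_filter, mem_gtFinset, Set.mem_ofPred_eq]
  exact ⟨fun h => h.2, fun h => ⟨⟨h.1, h.2.1⟩, h⟩⟩

theorem lrCoeff_nonneg {n : ℕ} {lam mu nu : Fin n → ℕ} (hlam : Antitone lam)
    (hmu : Antitone mu) (hnu : Antitone nu) : 0 ≤ lrCoeff n lam mu nu := by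
  rw [lrCoeff_eq_ncard hlam hmu hnu]
  exact Nat.cast_nonneg _

theorem le_sum_of_lrCoeff_ne_zero {n : ℕ} {lam mu nu : Fin n → ℕ} (hlam : Antitone lam)
    (hmu : Antitone mu) (hnu : Antitone nu) (h : lrCoeff n lam mu nu ≠ 0) (i : Fin n) :
    mu i ≤ ∑ k, nu k := by
  rw [lrCoeff_eq_ncard hlam hmu hnu] at h
  obtain ⟨g, hg, -, hw⟩ := Set.nonempty_of_ncard_ne_zero (Nat.cast_ne_zero.1 h)
  have h1 := hg.sum_gtWeight
  rw [Finset.sum_range, Finset.sum_range] at h1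
  have h2 : ∑ k, (mu k : ℤ) ≤ ∑ k, (nu k : ℤ) := by
    have h3 : ∑ k : Fin n, zext mu k = ∑ k, (mu k : ℤ) :=
      Finset.sum_congr rfl fun k _ => zext_of_lt mu k.isLt
    rw [← h3, ← h1]
    refine Finset.sum_le_sum fun k _ => ?_
    have := hw k k.isLt
    rw [zext_of_lt lam k.isLt, zext_of_lt nu k.isLt] at this
    have h4 : (0 : ℤ) ≤ lam k := Nat.cast_nonneg _
    simp only [Fin.eta] at this
    linarith
  have h5 : ∑ k, mu k ≤ ∑ k, nu k := by exact_mod_cast h2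
  exact (Finset.single_le_sum (fun _ _ => Nat.zero_le _) (Finset.mem_univ i)).trans h5

theorem lrCoeff_le_lrCoeff_mul {n : ℕ} {lam mu nu : Fin n → ℕ} (hlam : Antitone lam)
    (hmu : Antitone mu) (hnu : Antitone nu) {r : ℕ} (hr : 1 ≤ r) :
    lrCoeff n lam mu nu ≤
      lrCoeff n (fun i => r * lam i) (fun i => r * mu i) (fun i => r * nu i) := by
  rw [lrCoeff_eq_ncard hlam hmu hnu, lrCoeff_eq_ncard (hlam.const_mul' r) (hmu.const_mul' r)
    (hnu.const_mul' r), Nat.cast_le]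
  have hr0 : (0 : ℤ) ≤ r := Nat.cast_nonneg r
  refine Set.ncard_le_ncard_of_injOn (fun g p i => (r : ℤ) * g p i) (fun g hg => ?_)
    (fun g _ g' _ h => ?_) (finite_lrSet _ _ _ _)
  · obtain ⟨hg, hgood, hw⟩ := hg
    refine ⟨⟨fun i => ?_, fun p i hp => ?_, fun p i hp => ?_, fun p i hp => ?_, fun p i hp => ?_⟩,
      fun k i hk hi => ?_, fun k hk => ?_⟩
    · rw [zext_mul, hg.top]
    · rw [hg.zero p i hp, mul_zero]
    · rw [hg.above p i hp, mul_zero]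
    · exact mul_le_mul_of_nonneg_left (hg.le p i hp) hr0
    · exact mul_le_mul_of_nonneg_left (hg.ge p i hp) hr0
    · have := mul_nonneg hr0 (hgood k i hk hi)
      simp only [gtDefect, zext_mul, ← mul_sub, ← Finset.mul_sum, ← mul_add] at this ⊢
      exact this
    · have := hw k hk
      simp only [gtWeight, rowSum, zext_mul, ← mul_sub, ← Finset.mul_sum, ← mul_add] at this ⊢
      rw [this]
  · funext p i
    have := congrFun (congrFun h p) i
    exact mul_left_cancel₀ (by exact_mod_cast (by omega : r ≠ 0)) this

/-- The summand of the generalized Littlewood–Richardson coefficient. -/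
def genLRTerm (n m : ℕ) (lam : ℕ → Fin n → ℕ) (mu : Fin (m - 3) → Fin n → ℕ) : ℤ :=
  open Classical in
  if ∀ k, Antitone (mu k) then
    ∏ j ∈ Finset.range (m - 2),
      lrCoeff n (chainNu n m lam mu j) (chainNu n m lam mu (j + 1)) (lam (j + 2))
  else 0

theorem genLR_eq_finsum (n m : ℕ) (lam : ℕ → Fin n → ℕ) :
    genLR n m lam = ∑ᶠ mu, genLRTerm n m lam mu := by
  unfold genLR genLRTerm
  congr! 2

theorem antitone_chainNu {n m : ℕ} (hm : 3 ≤ m) {lam : ℕ → Fin n → ℕ}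
    (hlam : ∀ i, 1 ≤ i → i ≤ m → Antitone (lam i)) {mu : Fin (m - 3) → Fin n → ℕ}
    (hmu : ∀ k, Antitone (mu k)) (j : ℕ) : Antitone (chainNu n m lam mu j) := by
  unfold chainNu
  split_ifs
  · exact hlam 1 le_rfl (by omega)
  · exact hlam m (by omega) le_rfl
  · exact hmu _
  · exact antitone_const

theorem chainNu_mul {n m : ℕ} (r : ℕ) (lam : ℕ → Fin n → ℕ) (mu : Fin (m - 3) → Fin n → ℕ)
    (j : ℕ) :
    chainNu n m (fun i k => r * lam i k) (fun i k => r * mu i k) j =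
      fun k => r * chainNu n m lam mu j k := by
  unfold chainNu
  split_ifs <;> simp
  rfl

theorem genLRTerm_nonneg {n m : ℕ} (hm : 3 ≤ m) {lam : ℕ → Fin n → ℕ}
    (hlam : ∀ i, 1 ≤ i → i ≤ m → Antitone (lam i)) (mu : Fin (m - 3) → Fin n → ℕ) :
    0 ≤ genLRTerm n m lam mu := by
  unfold genLRTerm
  split_ifs with h
  · refine Finset.prod_nonneg fun j hj => ?_
    have := Finset.mem_range.1 hj
    exact lrCoeff_nonneg (antitone_chainNu hm hlam h _) (antitone_chainNu hm hlam h _)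
      (hlam _ (by omega) (by omega))
  · exact le_rfl

theorem finite_support_genLRTerm {n m : ℕ} (hm : 3 ≤ m) {lam : ℕ → Fin n → ℕ}
    (hlam : ∀ i, 1 ≤ i → i ≤ m → Antitone (lam i)) :
    (Function.support (genLRTerm n m lam)).Finite := by
  refine (Set.Finite.pi fun k : Fin (m - 3) => Set.Finite.pi fun _ : Fin n =>
    Set.finite_Iic (∑ l, lam (k + 2) l)).subset fun mu hmu k _ i _ => ?_
  rw [Function.mem_support, genLRTerm] at hmu
  split_ifs at hmu with h
  · have hk := k.isLt
    have hne := Finset.prod_ne_zero_iff.1 hmu k (Finset.mem_range.2 (by omega))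
    have hle := le_sum_of_lrCoeff_ne_zero (antitone_chainNu hm hlam h _)
      (antitone_chainNu hm hlam h _) (hlam _ (by omega) (by omega)) hne i
    have he : chainNu n m lam mu (k + 1) = mu k := by
      have h1 : (k : ℕ) + 1 ≠ m - 2 := by omega
      simp [chainNu, h1]
    rwa [he] at hle
  · exact absurd rfl hmu

theorem genLRTerm_le_genLRTerm_mul {n m : ℕ} (hm : 3 ≤ m) {lam : ℕ → Fin n → ℕ}
    (hlam : ∀ i, 1 ≤ i → i ≤ m → Antitone (lam i)) {r : ℕ} (hr : 1 ≤ r)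
    (mu : Fin (m - 3) → Fin n → ℕ) :
    genLRTerm n m lam mu ≤ genLRTerm n m (fun i k => r * lam i k) (fun i k => r * mu i k) := by
  by_cases h : ∀ k, Antitone (mu k)
  · rw [genLRTerm, genLRTerm, if_pos h, if_pos fun k => (h k).const_mul' r]
    have hl : ∀ j ∈ Finset.range (m - 2), Antitone (lam (j + 2)) := fun j hj => by
      have := Finset.mem_range.1 hj
      exact hlam _ (by omega) (by omega)
    refine Finset.prod_le_prod (fun j hj => lrCoeff_nonneg (antitone_chainNu hm hlam h _)
      (antitone_chainNu hm hlam h _) (hl j hj)) fun j hj => ?_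
    rw [chainNu_mul, chainNu_mul]
    exact lrCoeff_le_lrCoeff_mul (antitone_chainNu hm hlam h _) (antitone_chainNu hm hlam h _)
      (hl j hj) hr
  · rw [genLRTerm, if_neg h]
    exact genLRTerm_nonneg hm (fun i h1 h2 => (hlam i h1 h2).const_mul' r) _

theorem genLR_le_genLR_mul {n m : ℕ} (hm : 3 ≤ m) {lam : ℕ → Fin n → ℕ}
    (hlam : ∀ i, 1 ≤ i → i ≤ m → Antitone (lam i)) {r : ℕ} (hr : 1 ≤ r) :
    genLR n m lam ≤ genLR n m (fun i j => r * lam i j) := by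
  classical
  have hlam' : ∀ i, 1 ≤ i → i ≤ m → Antitone fun j => r * lam i j :=
    fun i h1 h2 => (hlam i h1 h2).const_mul' r
  have hs := finite_support_genLRTerm hm hlam
  have hs' := finite_support_genLRTerm hm hlam'
  have hinj : Function.Injective fun (mu : Fin (m - 3) → Fin n → ℕ) i k => r * mu i k := by
    intro mu mu' h
    funext i k
    exact Nat.eq_of_mul_eq_mul_left hr (congrFun (congrFun h i) k)
  rw [genLR_eq_finsum, genLR_eq_finsum, finsum_eq_sum _ hs,
    finsum_eq_sum_of_support_subset (s := hs'.toFinset ∪ hs.toFinset.map ⟨_, hinj⟩) _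
      (fun mu hmu => by simpa using Or.inl hmu)]
  calc ∑ mu ∈ hs.toFinset, genLRTerm n m lam mu
      ≤ ∑ mu ∈ hs.toFinset, genLRTerm n m (fun i k => r * lam i k) (fun i k => r * mu i k) :=
        Finset.sum_le_sum fun mu _ => genLRTerm_le_genLRTerm_mul hm hlam hr mu
    _ = ∑ mu ∈ hs.toFinset.map ⟨_, hinj⟩, genLRTerm n m (fun i k => r * lam i k) mu := by
        rw [Finset.sum_map]
        rfl
    _ ≤ _ := Finset.sum_le_sum_of_subset_of_nonneg Finset.subset_union_right
        fun mu _ _ => genLRTerm_nonneg hm hlam' mu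

/-- Monotonicity of the generalized Littlewood–Richardson coefficients under
stretching: for partitions `λ(1), …, λ(m)` with at most `n` parts and any
`r ≥ 1`, `f(λ(1),…,λ(m)) ≤ f(rλ(1),…,rλ(m))`; in particular if
`f(rλ(1),…,rλ(m)) = 1` for some `r ≥ 1` then `f(λ(1),…,λ(m)) ≤ 1`. -/
theorem genLR_monotone (n m : ℕ) (hn : 1 ≤ n) (hm : 3 ≤ m)
    (lam : ℕ → Fin n → ℕ) (hlam : ∀ i, 1 ≤ i → i ≤ m → Antitone (lam i))
    (r : ℕ) (hr : 1 ≤ r) :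
    genLR n m lam ≤ genLR n m (fun i j => r * lam i j) ∧
      (genLR n m (fun i j => r * lam i j) = 1 → genLR n m lam ≤ 1) := by
  have h := genLR_le_genLR_mul hm hlam hr
  exact ⟨h, fun h1 => h.trans_eq h1⟩

end
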